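/- Let M be a deterministic, truthful, proportional two-agent cake-cutting mechanism, and suppose on the uniform-uniform input (f_1 = f_2 ≡ 1) it outputs pieces (X_1, X_2) with |X_1| = |X_2| = 1/2. Then on the input where agent 1 reports the uniform density and agent 2 reports the density equal to ε on X_1 and 1 on X_2 (for sufficiently small ε > 0), M must output exactly (X_1, X_2). -/

import Mathlib

open MeasureTheory Set
open scoped Classical

/-- The value of set `X` under value density function `f`. -/
noncomputable def val (f : ℝ → ℝ) (X : Set ℝ) : ℝ := ∫ t in X, f t

/-- An admissible value density function: measurable and nonnegative. -/
def Adm (f : ℝ → ℝ) : Prop := Measurable f ∧ ∀ x, 0 ≤ f x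


/-- Measure of the part of `X` in a cell. -/
noncomputable def cm (C X : Set ℝ) : ℝ := volume.real (X ∩ C)

lemma cm_nonneg (C X : Set ℝ) : 0 ≤ cm C X := measureReal_nonneg

lemma cm_add_le {C X Y : Set ℝ} (hX : X ⊆ Icc 0 1) (hY : Y ⊆ Icc 0 1) (hYm : MeasurableSet Y)
    (hC : MeasurableSet C) (hd : Disjoint X Y) : cm C X + cm C Y ≤ cm C (Icc 0 1) := by
  unfold cm
  have fin : ∀ Z : Set ℝ, Z ⊆ Icc 0 1 → volume Z ≠ ⊤ := fun Z hZ =>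
    ne_top_of_le_ne_top (by simp) (measure_mono (μ := volume) hZ)
  rw [← measureReal_union (hd.mono inter_subset_left inter_subset_left) (hYm.inter hC)
    (fin _ (inter_subset_left.trans hX)) (fin _ (inter_subset_left.trans hY))]
  apply measureReal_mono _ (fin _ inter_subset_left)
  rw [← union_inter_distrib_right]
  exact inter_subset_inter_left _ (union_subset hX hY)

/-- The value of a piece under a density constant on each of the four cells. -/
lemma val_eq {A B P X : Set ℝ} (hA : MeasurableSet A) (hB : MeasurableSet B)
    (hP : MeasurableSet P) (hAI : A ⊆ Icc 0 1) (hBI : B ⊆ Icc 0 1) (hAB : Disjoint A B)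
    (hvA : volume A = 1/2) (hvB : volume B = 1/2)
    (hX : MeasurableSet X) (hXI : X ⊆ Icc 0 1) (f : ℝ → ℝ) (a b c d : ℝ)
    (h1 : ∀ x ∈ A ∩ P, f x = a) (h2 : ∀ x ∈ A \ P, f x = b)
    (h3 : ∀ x ∈ B ∩ P, f x = c) (h4 : ∀ x ∈ B \ P, f x = d) :
    val f X = a * cm (A ∩ P) X + b * cm (A \ P) X + c * cm (B ∩ P) X + d * cm (B \ P) X := by
  have hnull : volume (Icc (0:ℝ) 1 \ (A ∪ B)) = 0 := by
    rw [measure_sdiff (union_subset hAI hBI) (hA.union hB).nullMeasurableSet]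
    · rw [measure_union hAB hB, hvA, hvB]
      simp [ENNReal.inv_two_add_inv_two]
    · exact ne_top_of_le_ne_top (by simp) (measure_mono (μ := volume) (union_subset hAI hBI))
  have hae : ∀ᵐ x ∂(volume.restrict X), f x =
      (A ∩ P).indicator (fun _ => a) x + (A \ P).indicator (fun _ => b) x
      + (B ∩ P).indicator (fun _ => c) x + (B \ P).indicator (fun _ => d) x := by
    rw [ae_restrict_iff' hX]
    have : ∀ᵐ x ∂volume, x ∉ Icc (0:ℝ) 1 \ (A ∪ B) := measure_eq_zero_iff_ae_notMem.mp hnull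
    filter_upwards [this] with x hx hxX
    have hxI := hXI hxX
    have hU : x ∈ A ∪ B := by
      by_contra hc; exact hx ⟨hxI, hc⟩
    by_cases hxP : x ∈ P
    · rcases hU with hxA | hxB
      · have hxB : x ∉ B := fun h => disjoint_left.mp hAB hxA h
        simp [indicator, hxA, hxB, hxP, h1 x ⟨hxA, hxP⟩]
      · have hxA : x ∉ A := fun h => disjoint_left.mp hAB h hxB
        simp [indicator, hxA, hxB, hxP, h3 x ⟨hxB, hxP⟩]
    · rcases hU with hxA | hxB
      · have hxB : x ∉ B := fun h => disjoint_left.mp hAB hxA h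
        simp [indicator, hxA, hxB, hxP, h2 x ⟨hxA, hxP⟩]
      · have hxA : x ∉ A := fun h => disjoint_left.mp hAB h hxB
        simp [indicator, hxA, hxB, hxP, h4 x ⟨hxB, hxP⟩]
  have hXf : volume X ≠ ⊤ := ne_top_of_le_ne_top (by simp) (measure_mono (μ := volume) hXI)
  have hint : ∀ (C : Set ℝ) (w : ℝ), MeasurableSet C →
      Integrable (C.indicator (fun _ => w)) (volume.restrict X) := by
    intro C w hC
    haveI : IsFiniteMeasure (volume.restrict X) := ⟨by
      rw [Measure.restrict_apply_univ]; exact lt_top_iff_ne_top.mpr hXf⟩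
    exact (integrable_const w).indicator hC
  have hval : ∀ (C : Set ℝ) (w : ℝ), MeasurableSet C →
      ∫ x in X, C.indicator (fun _ => w) x = w * cm C X := by
    intro C w hC
    rw [integral_indicator hC, setIntegral_const, smul_eq_mul, mul_comm]
    unfold cm
    rw [measureReal_restrict_apply hC, inter_comm]
  have m1 := hA.inter hP
  have m2 := hA.diff hP
  have m3 := hB.inter hP
  have m4 := hB.diff hP
  unfold val
  rw [integral_congr_ae hae, integral_add, integral_add, integral_add, hval _ _ m1, hval _ _ m2,
    hval _ _ m3, hval _ _ m4]
  · exact hint _ _ m1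
  · exact hint _ _ m2
  · exact (hint _ _ m1).add (hint _ _ m2)
  · exact hint _ _ m3
  · exact ((hint _ _ m1).add (hint _ _ m2)).add (hint _ _ m3)
  · exact hint _ _ m4

/-- If a deterministic, truthful, proportional two-agent mechanism outputs pieces
`(X₁, X₂)` of measure `1/2` each on the uniform-uniform input, then on the input where
agent 1 is uniform and agent 2 reports `ε` on `X₁` and `1` on `X₂` (for sufficiently small
`ε > 0`), the mechanism must output exactly `(X₁, X₂)`. -/
theorem output_on_instance_two
    (M : (ℝ → ℝ) → (ℝ → ℝ) → Set ℝ × Set ℝ)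
    (hSets : ∀ f₁ f₂, Adm f₁ → Adm f₂ →
      MeasurableSet (M f₁ f₂).1 ∧ MeasurableSet (M f₁ f₂).2 ∧
      (M f₁ f₂).1 ⊆ Set.Icc 0 1 ∧ (M f₁ f₂).2 ⊆ Set.Icc 0 1 ∧
      Disjoint (M f₁ f₂).1 (M f₁ f₂).2)
    (hProp : ∀ f₁ f₂, Adm f₁ → Adm f₂ →
      val f₁ (M f₁ f₂).1 ≥ (1/2) * val f₁ (Set.Icc 0 1) ∧
      val f₂ (M f₁ f₂).2 ≥ (1/2) * val f₂ (Set.Icc 0 1))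
    (hTruth1 : ∀ f₁ f₁' f₂, Adm f₁ → Adm f₁' → Adm f₂ →
      val f₁ (M f₁ f₂).1 ≥ val f₁ (M f₁' f₂).1)
    (hTruth2 : ∀ f₁ f₂ f₂', Adm f₁ → Adm f₂ → Adm f₂' →
      val f₂ (M f₁ f₂).2 ≥ val f₂ (M f₁ f₂').2)
    (X₁ X₂ : Set ℝ)
    (hUnif : M (fun _ => 1) (fun _ => 1) = (X₁, X₂))
    (hX₁ : volume X₁ = 1/2) (hX₂ : volume X₂ = 1/2) :
    ∃ ε₀ > (0:ℝ), ∀ ε : ℝ, 0 < ε → ε < ε₀ →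
      M (fun _ => 1) (fun x => if x ∈ X₁ then ε else 1) = (X₁, X₂) := by
  exfalso
  let u : ℝ → ℝ := fun _ => 1
  let h : ℝ → ℝ := fun x => if x ∈ X₁ then 1/2 else 1
  let g : ℝ → ℝ := fun x => if x ∈ X₁ then 0 else 1
  have hu : Adm u := ⟨measurable_const, fun _ => zero_le_one⟩
  have h0 := hSets u u hu hu
  rw [show M u u = (X₁, X₂) from hUnif] at h0
  obtain ⟨hA, hB, hAI, hBI, hAB⟩ := h0
  simp only at hA hB hAI hBI hAB
  have hh : Adm h := ⟨Measurable.ite hA measurable_const measurable_const, fun x => by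
    simp only [h]; split_ifs <;> norm_num⟩
  have hg : Adm g := ⟨Measurable.ite hA measurable_const measurable_const, fun x => by
    simp only [g]; split_ifs <;> norm_num⟩
  set P : Set ℝ := (M h g).1 with hPdef
  have hP : MeasurableSet P := (hSets h g hh hg).1
  have hPI : P ⊆ Icc 0 1 := (hSets h g hh hg).2.2.1
  let q : ℝ → ℝ := fun x => if x ∈ X₁ then (if x ∈ P then 1/2 else 0) else 1
  let p : ℝ → ℝ := fun x => if x ∈ X₁ then (if x ∈ P then 2 else 1)
    else (if x ∈ P then 5/4 else 0)
  have hq : Adm q := ⟨Measurable.ite hA (Measurable.ite hP measurable_const measurable_const)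
    measurable_const, fun x => by simp only [q]; split_ifs <;> norm_num⟩
  have hp : Adm p := ⟨Measurable.ite hA (Measurable.ite hP measurable_const measurable_const)
    (Measurable.ite hP measurable_const measurable_const), fun x => by
      simp only [p]; split_ifs <;> norm_num⟩
  have nA : ∀ x, x ∈ X₂ → x ∉ X₁ := fun x hx h => disjoint_left.mp hAB h hx
  have vu : ∀ X, MeasurableSet X → X ⊆ Icc 0 1 → val u X = 1 * cm (X₁ ∩ P) X + 1 * cm (X₁ \ P) X
      + 1 * cm (X₂ ∩ P) X + 1 * cm (X₂ \ P) X := fun X hX hXI =>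
    val_eq hA hB hP hAI hBI hAB hX₁ hX₂ hX hXI u 1 1 1 1 (by simp [u]) (by simp [u])
      (by simp [u]) (by simp [u])
  have vh : ∀ X, MeasurableSet X → X ⊆ Icc 0 1 → val h X = (1/2) * cm (X₁ ∩ P) X
      + (1/2) * cm (X₁ \ P) X + 1 * cm (X₂ ∩ P) X + 1 * cm (X₂ \ P) X := fun X hX hXI =>
    val_eq hA hB hP hAI hBI hAB hX₁ hX₂ hX hXI h _ _ _ _
      (fun x hx => by simp [h, hx.1]) (fun x hx => by simp [h, hx.1])
      (fun x hx => by simp [h, nA x hx.1]) (fun x hx => by simp [h, nA x hx.1])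
  have vg : ∀ X, MeasurableSet X → X ⊆ Icc 0 1 → val g X = 0 * cm (X₁ ∩ P) X
      + 0 * cm (X₁ \ P) X + 1 * cm (X₂ ∩ P) X + 1 * cm (X₂ \ P) X := fun X hX hXI =>
    val_eq hA hB hP hAI hBI hAB hX₁ hX₂ hX hXI g _ _ _ _
      (fun x hx => by simp [g, hx.1]) (fun x hx => by simp [g, hx.1])
      (fun x hx => by simp [g, nA x hx.1]) (fun x hx => by simp [g, nA x hx.1])
  have vq : ∀ X, MeasurableSet X → X ⊆ Icc 0 1 → val q X = (1/2) * cm (X₁ ∩ P) X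
      + 0 * cm (X₁ \ P) X + 1 * cm (X₂ ∩ P) X + 1 * cm (X₂ \ P) X := fun X hX hXI =>
    val_eq hA hB hP hAI hBI hAB hX₁ hX₂ hX hXI q _ _ _ _
      (fun x hx => by simp [q, hx.1, hx.2]) (fun x hx => by simp [q, hx.1, hx.2])
      (fun x hx => by simp [q, nA x hx.1]) (fun x hx => by simp [q, nA x hx.1])
  have vp : ∀ X, MeasurableSet X → X ⊆ Icc 0 1 → val p X = 2 * cm (X₁ ∩ P) X
      + 1 * cm (X₁ \ P) X + (5/4) * cm (X₂ ∩ P) X + 0 * cm (X₂ \ P) X := fun X hX hXI =>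
    val_eq hA hB hP hAI hBI hAB hX₁ hX₂ hX hXI p _ _ _ _
      (fun x hx => by simp [p, hx.1, hx.2]) (fun x hx => by simp [p, hx.1, hx.2])
      (fun x hx => by simp [p, nA x hx.1, hx.2]) (fun x hx => by simp [p, nA x hx.1, hx.2])
  -- cell sizes
  have mI : MeasurableSet (Icc (0:ℝ) 1) := measurableSet_Icc
  have cell : ∀ C : Set ℝ, C ⊆ Icc 0 1 → cm C (Icc 0 1) = volume.real C := fun C hC => by
    unfold cm; rw [inter_eq_self_of_subset_right hC]
  have finA : volume X₁ ≠ ⊤ := by rw [hX₁]; simp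
  have finB : volume X₂ ≠ ⊤ := by rw [hX₂]; simp
  have sA : cm (X₁ ∩ P) (Icc 0 1) + cm (X₁ \ P) (Icc 0 1) = 1/2 := by
    rw [cell _ (inter_subset_left.trans hAI), cell _ (sdiff_subset.trans hAI),
      measureReal_inter_add_sdiff hP finA]
    simp [measureReal_def, hX₁]
  have sB : cm (X₂ ∩ P) (Icc 0 1) + cm (X₂ \ P) (Icc 0 1) = 1/2 := by
    rw [cell _ (inter_subset_left.trans hBI), cell _ (sdiff_subset.trans hBI),
      measureReal_inter_add_sdiff hP finB]
    simp [measureReal_def, hX₂]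
  -- the pieces X₁, X₂, P
  have A1 : cm (X₁ ∩ P) X₁ = cm (X₁ ∩ P) (Icc 0 1) := by
    rw [cell _ (inter_subset_left.trans hAI)]; unfold cm
    rw [inter_eq_self_of_subset_right inter_subset_left]
  have A2 : cm (X₁ \ P) X₁ = cm (X₁ \ P) (Icc 0 1) := by
    rw [cell _ (sdiff_subset.trans hAI)]; unfold cm
    rw [inter_eq_self_of_subset_right sdiff_subset]
  have B1 : cm (X₂ ∩ P) X₂ = cm (X₂ ∩ P) (Icc 0 1) := by
    rw [cell _ (inter_subset_left.trans hBI)]; unfold cm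
    rw [inter_eq_self_of_subset_right inter_subset_left]
  have B2 : cm (X₂ \ P) X₂ = cm (X₂ \ P) (Icc 0 1) := by
    rw [cell _ (sdiff_subset.trans hBI)]; unfold cm
    rw [inter_eq_self_of_subset_right sdiff_subset]
  have P1 : cm (X₁ ∩ P) P = cm (X₁ ∩ P) (Icc 0 1) := by
    rw [cell _ (inter_subset_left.trans hAI)]; unfold cm
    rw [inter_eq_self_of_subset_right inter_subset_right]
  have P3 : cm (X₂ ∩ P) P = cm (X₂ ∩ P) (Icc 0 1) := by
    rw [cell _ (inter_subset_left.trans hBI)]; unfold cm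
    rw [inter_eq_self_of_subset_right inter_subset_right]
  have P2 : cm (X₁ \ P) P = 0 := by unfold cm; simp
  have P4 : cm (X₂ \ P) P = 0 := by unfold cm; simp
  have m1 := hA.inter hP
  have m2 := hA.diff hP
  have m3 := hB.inter hP
  have m4 := hB.diff hP
  -- all bounds for one instance
  have facts : ∀ f₁ f₂, Adm f₁ → Adm f₂ → ∀ C, MeasurableSet C →
      0 ≤ cm C (M f₁ f₂).1 ∧ 0 ≤ cm C (M f₁ f₂).2 ∧
      cm C (M f₁ f₂).1 + cm C (M f₁ f₂).2 ≤ cm C (Icc 0 1) := by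
    intro f₁ f₂ a₁ a₂ C hC
    obtain ⟨_, s2, s3, s4, s5⟩ := hSets f₁ f₂ a₁ a₂
    exact ⟨cm_nonneg _ _, cm_nonneg _ _, cm_add_le s3 s4 s2 hC s5⟩
  -- generic: if agent 2 values every part of X₂ at 1 and X₁ at most 1/2, then M u f = (X₁, X₂)
  -- instance (u, g)
  have ug1 : cm (X₁ ∩ P) (M u g).1 + cm (X₁ \ P) (M u g).1 + cm (X₂ ∩ P) (M u g).1
      + cm (X₂ \ P) (M u g).1 ≤ 1/2 := by
    have t := hTruth2 u g u hu hg hu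
    rw [show M u u = (X₁, X₂) from hUnif] at t
    rw [vg _ (hSets u g hu hg).2.1 (hSets u g hu hg).2.2.2.1, vg _ hB hBI] at t
    have := facts u g hu hg _ m1
    have := facts u g hu hg _ m2
    have := facts u g hu hg _ m3
    have := facts u g hu hg _ m4
    linarith
  have uq1 : cm (X₁ ∩ P) (M u q).1 + cm (X₁ \ P) (M u q).1 + cm (X₂ ∩ P) (M u q).1
      + cm (X₂ \ P) (M u q).1 ≤ 1/2 ∧ cm (X₁ ∩ P) (Icc 0 1) ≤ cm (X₁ ∩ P) (M u q).1 ∧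
      cm (X₁ \ P) (Icc 0 1) ≤ cm (X₁ \ P) (M u q).1 := by
    have t := hTruth2 u q u hu hq hu
    rw [show M u u = (X₁, X₂) from hUnif] at t
    rw [vq _ (hSets u q hu hq).2.1 (hSets u q hu hq).2.2.2.1, vq _ hB hBI, B1, B2] at t
    have r := (hProp u q hu hq).1
    rw [vu _ (hSets u q hu hq).1 (hSets u q hu hq).2.2.1, vu _ mI subset_rfl] at r
    have := facts u q hu hq _ m1
    have := facts u q hu hq _ m2
    have := facts u q hu hq _ m3
    have := facts u q hu hq _ m4
    have := cm_nonneg (X₁ ∩ P) X₂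
    refine ⟨?_, ?_, ?_⟩ <;> linarith
  -- instance (h, g) : all four cells have measure 1/4
  have hgP : cm (X₁ ∩ P) (Icc 0 1) = 1/4 ∧ cm (X₂ ∩ P) (Icc 0 1) = 1/4 := by
    have t := hTruth1 u h g hu hh hg
    rw [vu _ (hSets u g hu hg).1 (hSets u g hu hg).2.2.1, ← hPdef, vu _ hP hPI, P1, P2, P3, P4] at t
    have r := hProp h g hh hg
    rw [← hPdef, vh _ hP hPI, vh _ mI subset_rfl, P1, P2, P3, P4,
      vg _ (hSets h g hh hg).2.1 (hSets h g hh hg).2.2.2.1, vg _ mI subset_rfl] at r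
    obtain ⟨r1, r2⟩ := r
    have f3 := facts h g hh hg _ m3
    have f4 := facts h g hh hg _ m4
    rw [← hPdef, P3] at f3
    rw [← hPdef, P4] at f4
    constructor <;> linarith
  obtain ⟨e1, e3⟩ := hgP
  -- instance (p, g) : agent 2 gets exactly half of X₂
  have pg : cm (X₂ ∩ P) (M p g).2 + cm (X₂ \ P) (M p g).2 ≤ 1/4 := by
    have t := hTruth1 u p g hu hp hg
    rw [vu _ (hSets u g hu hg).1 (hSets u g hu hg).2.2.1,
      vu _ (hSets p g hp hg).1 (hSets p g hp hg).2.2.1] at t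
    have t' := hTruth1 p h g hp hh hg
    rw [vp _ (hSets p g hp hg).1 (hSets p g hp hg).2.2.1, ← hPdef, vp _ hP hPI,
      P1, P2, P3, P4] at t'
    have := facts p g hp hg _ m1
    have := facts p g hp hg _ m2
    have := facts p g hp hg _ m3
    have := facts p g hp hg _ m4
    linarith
  -- instance (p, q)
  have t1 := hTruth1 u p q hu hp hq
  rw [vu _ (hSets u q hu hq).1 (hSets u q hu hq).2.2.1,
    vu _ (hSets p q hp hq).1 (hSets p q hp hq).2.2.1] at t1
  have t2 := hTruth1 p u q hp hu hq
  rw [vp _ (hSets p q hp hq).1 (hSets p q hp hq).2.2.1,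
    vp _ (hSets u q hu hq).1 (hSets u q hu hq).2.2.1] at t2
  have t3 := hTruth2 p g q hp hg hq
  rw [vg _ (hSets p g hp hg).2.1 (hSets p g hp hg).2.2.2.1,
    vg _ (hSets p q hp hq).2.1 (hSets p q hp hq).2.2.2.1] at t3
  have t4 := (hProp p q hp hq).2
  rw [vq _ (hSets p q hp hq).2.1 (hSets p q hp hq).2.2.2.1, vq _ mI subset_rfl] at t4
  have := facts p q hp hq _ m1
  have := facts p q hp hq _ m2
  have := facts p q hp hq _ m3
  have := facts p q hp hq _ m4
  have := facts u q hu hq _ m3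
  have := facts u q hu hq _ m4
  obtain ⟨w1, w2, w3⟩ := uq1
  linarith
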